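/- For every real M > 0 there exists a nonzero polynomial Q ∈ ℂ[X], depending only on M, k and the data (λ_j, m_j, n_j) (and not on φ), such that for every Schwartz function φ ∈ 𝓢(ℝ^k, ℂ) there exists a function H : ℂ → ℂ which is holomorphic on the half-plane {s : Re(s) > −M} and satisfies Q(s)·F_φ(s) = H(s) for every s with Re(s) > −M and Re(s) > −Re(λ_j) for all 1 ≤ j ≤ k. In particular F_φ, initially defined on its half-plane of absolute convergence, extends meromorphically to {s : Re(s) > −M}, and hence (M being arbitrary) to all of ℂ. -/

import Mathlib

open MeasureTheory

/-- The integrand of the generalized Mellin transform on ℝ^k: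
a ↦ φ(a)·∏_{j} (sgn a_j)^{m_j}·|a_j|^{s+λ_j−1}·(log|a_j|)^{n_j},
taken to be 0 on the measure-zero set where some a_j = 0. Here |t|^w denotes
the complex power of the positive real |t|. -/
noncomputable def mellinIntegrand (k : ℕ) (lam : Fin k → ℂ) (m n : Fin k → ℕ)
    (φ : SchwartzMap (Fin k → ℝ) ℂ) (s : ℂ) (a : Fin k → ℝ) : ℂ :=
  if ∀ j, a j ≠ 0 then
    φ a * ∏ j, ((Real.sign (a j) : ℝ) : ℂ) ^ (m j) *
      ((|a j| : ℝ) : ℂ) ^ (s + lam j - 1) * ((Real.log |a j| : ℝ) : ℂ) ^ (n j)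
  else 0

/-- The generalized Mellin transform F_φ(s) (with respect to Lebesgue measure on ℝ^k). -/
noncomputable def mellinF (k : ℕ) (lam : Fin k → ℂ) (m n : Fin k → ℕ)
    (φ : SchwartzMap (Fin k → ℝ) ℂ) (s : ℂ) : ℂ :=
  ∫ a, mellinIntegrand k lam m n φ s a ∂(volume : Measure (Fin k → ℝ))

/-- Integrable majorant on the line. -/
noncomputable def mellinW (δ : ℝ) (t : ℝ) : ℝ :=
  Set.indicator (Set.Icc (-1) 1) (fun t : ℝ => |t| ^ (δ - 1)) t + (1 + t ^ 2)⁻¹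

lemma mellinW_integrable (δ : ℝ) (hδ : 0 < δ) : Integrable (mellinW δ) := by
  unfold mellinW
  refine Integrable.add ?_ integrable_inv_one_add_sq
  rw [integrable_indicator_iff measurableSet_Icc]
  have h1 : IntervalIntegrable (fun t : ℝ => |t| ^ (δ - 1)) volume 0 1 := by
    refine (intervalIntegral.intervalIntegrable_rpow' (r := δ - 1) (by linarith)).congr ?_
    intro t ht
    rw [Set.uIoc_of_le zero_le_one] at ht
    simp only
    rw [abs_of_pos ht.1]
  have h2 : IntervalIntegrable (fun t : ℝ => |t| ^ (δ - 1)) volume (-1) 0 := by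
    have := (IntervalIntegrable.iff_comp_neg (f := fun t : ℝ => |t| ^ (δ - 1)) (a := 0) (b := 1)).1 h1
    simpa using this.symm
  have h3 := h2.trans h1
  rw [intervalIntegrable_iff_integrableOn_Icc_of_le (by norm_num)] at h3
  exact h3

lemma mellinW_nonneg (δ : ℝ) (t : ℝ) : 0 ≤ mellinW δ t := by
  unfold mellinW
  refine add_nonneg (Set.indicator_nonneg (fun t _ => by positivity) _) (by positivity)

lemma mellinW_bound (α β : ℝ) (hα : 0 < α) (n : ℕ) :
    ∃ (C : ℝ) (N : ℕ), 0 ≤ C ∧ ∀ t : ℝ, t ≠ 0 → ∀ σ : ℝ, α ≤ σ → σ ≤ β →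
      |t| ^ (σ - 1) * (1 + |Real.log (|t|)|) ^ n ≤ C * mellinW (α / 2) t * (1 + |t|) ^ N := by
  obtain ⟨B, hB⟩ := exists_nat_ge (β - 1)
  set ε : ℝ := α / 2 / (n + 1) with hε
  have hεp : 0 < ε := by positivity
  refine ⟨1 + (1 + 1 / ε) ^ n, B + n + 2, by positivity, ?_⟩
  intro t ht σ h1 h2
  have htp : 0 < |t| := abs_pos.2 ht
  set x := |t| with hx
  by_cases hx1 : x ≤ 1
  · have hw : x ^ (α / 2 - 1) ≤ mellinW (α / 2) t := by
      unfold mellinW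
      rw [Set.indicator_of_mem (by rw [Set.mem_Icc]; exact abs_le.1 hx1)]
      have : 0 ≤ (1 + t ^ 2)⁻¹ := by positivity
      linarith
    have e1 : x ^ (σ - 1) ≤ x ^ (α / 2 - 1) * (x ^ ε) ^ n := by
      rw [← Real.rpow_natCast, ← Real.rpow_mul htp.le, ← Real.rpow_add htp]
      apply Real.rpow_le_rpow_of_exponent_ge htp hx1
      have : ε * n ≤ α / 2 := by
        rw [hε, div_mul_eq_mul_div, div_le_iff₀ (by positivity)]
        nlinarith
      linarith
    have e2 : x ^ ε * (1 + |Real.log x|) ≤ 1 + 1 / ε := by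
      have a1 := (Real.abs_log_mul_self_rpow_lt x ε htp hx1 hεp).le
      rw [abs_mul, abs_of_nonneg (Real.rpow_nonneg htp.le ε)] at a1
      have a2 : x ^ ε ≤ 1 := Real.rpow_le_one htp.le hx1 hεp.le
      linarith
    calc x ^ (σ - 1) * (1 + |Real.log x|) ^ n
        ≤ (x ^ (α / 2 - 1) * (x ^ ε) ^ n) * (1 + |Real.log x|) ^ n := by gcongr
      _ = x ^ (α / 2 - 1) * (x ^ ε * (1 + |Real.log x|)) ^ n := by rw [mul_pow]; ring
      _ ≤ mellinW (α / 2) t * (1 + 1 / ε) ^ n := by gcongr; exact mellinW_nonneg _ _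
      _ ≤ (1 + (1 + 1 / ε) ^ n) * mellinW (α / 2) t * 1 := by
          nlinarith [mellinW_nonneg (α / 2) t]
      _ ≤ (1 + (1 + 1 / ε) ^ n) * mellinW (α / 2) t * (1 + x) ^ (B + n + 2) := by
          have := mellinW_nonneg (α / 2) t
          gcongr
          apply one_le_pow₀; linarith
  · push Not at hx1
    have hw : (1 + t ^ 2)⁻¹ ≤ mellinW (α / 2) t := by
      unfold mellinW
      have := Set.indicator_nonneg (s := Set.Icc (-1 : ℝ) 1) (f := fun t : ℝ => |t| ^ (α / 2 - 1))
        (fun t _ => by positivity) t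
      linarith
    have e1 : x ^ (σ - 1) ≤ x ^ B := by
      rw [← Real.rpow_natCast]
      exact Real.rpow_le_rpow_of_exponent_le hx1.le (by linarith)
    have e2 : 1 + |Real.log x| ≤ x := by
      rw [abs_of_nonneg (Real.log_nonneg hx1.le)]
      linarith [Real.log_le_sub_one_of_pos htp]
    have e3 : 1 ≤ (1 + t ^ 2)⁻¹ * (1 + x) ^ 2 := by
      rw [inv_mul_eq_div, le_div_iff₀ (by positivity), ← sq_abs t]
      nlinarith
    have hw0 := mellinW_nonneg (α / 2) t
    calc x ^ (σ - 1) * (1 + |Real.log x|) ^ n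
        ≤ x ^ B * x ^ n := by gcongr
      _ = x ^ (B + n) := by rw [pow_add]
      _ ≤ (1 + x) ^ (B + n) := by gcongr; linarith
      _ ≤ (1 + x) ^ (B + n) * ((1 + t ^ 2)⁻¹ * (1 + x) ^ 2) := by
          apply le_mul_of_one_le_right (by positivity) e3
      _ ≤ (1 + x) ^ (B + n) * (mellinW (α / 2) t * (1 + x) ^ 2) := by gcongr
      _ = 1 * mellinW (α / 2) t * (1 + x) ^ (B + n + 2) := by ring
      _ ≤ (1 + (1 + 1 / ε) ^ n) * mellinW (α / 2) t * (1 + x) ^ (B + n + 2) := by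
          gcongr
          have : 0 ≤ (1 + 1 / ε) ^ n := by positivity
          linarith

lemma schwartz_decay {k : ℕ} (φ : SchwartzMap (Fin k → ℝ) ℂ) (N : Fin k → ℕ) :
    ∃ C : ℝ, 0 ≤ C ∧ ∀ a, ‖φ a‖ * ∏ j, (1 + |a j|) ^ N j ≤ C := by
  have h := fun a => SchwartzMap.one_add_le_sup_seminorm_apply (𝕜 := ℝ) (m := (∑ j, N j, 0)) le_rfl
    le_rfl φ a
  refine ⟨_, ?_, fun a => le_trans ?_ (h a)⟩
  · exact le_trans (by positivity) (h 0)
  · simp only [norm_iteratedFDeriv_zero]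
    rw [mul_comm, ← Finset.prod_pow_eq_pow_sum]
    gcongr with j
    exact norm_le_pi_norm a j

lemma mellin_dom {k : ℕ} (φ : SchwartzMap (Fin k → ℝ) ℂ) (α β : Fin k → ℝ) (hα : ∀ j, 0 < α j)
    (n : Fin k → ℕ) :
    ∃ B : (Fin k → ℝ) → ℝ, Integrable B ∧ (∀ a, 0 ≤ B a) ∧ ∀ a : Fin k → ℝ, (∀ j, a j ≠ 0) →
      ∀ σ : Fin k → ℝ, (∀ j, α j ≤ σ j) → (∀ j, σ j ≤ β j) →
      ‖φ a‖ * ∏ j, (|a j| ^ (σ j - 1) * (1 + |Real.log (|a j|)|) ^ n j) ≤ B a := by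
  choose C N hC h using fun j => mellinW_bound (α j) (β j) (hα j) (n j)
  obtain ⟨D, hD, hφ⟩ := schwartz_decay φ N
  refine ⟨fun a => D * ∏ j, (C j * mellinW (α j / 2) (a j)), ?_, ?_, ?_⟩
  · apply Integrable.const_mul
    apply Integrable.fintype_prod
      (f := fun j t => C j * mellinW (α j / 2) t)
    intro j
    exact (mellinW_integrable _ (half_pos (hα j))).const_mul _
  · intro a
    exact mul_nonneg hD (Finset.prod_nonneg fun j _ => mul_nonneg (hC j) (mellinW_nonneg _ _))
  · intro a ha σ h1 h2
    calc _ ≤ ‖φ a‖ * ∏ j, (C j * mellinW (α j / 2) (a j) * (1 + |a j|) ^ N j) := by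
          refine mul_le_mul_of_nonneg_left (Finset.prod_le_prod ?_ fun j _ => ?_) (norm_nonneg _)
          · exact fun j _ => by positivity
          · exact h j (a j) (ha j) (σ j) (h1 j) (h2 j)
      _ = (‖φ a‖ * ∏ j, (1 + |a j|) ^ N j) * ∏ j, (C j * mellinW (α j / 2) (a j)) := by
          rw [Finset.prod_mul_distrib]; ring
      _ ≤ _ := by
          apply mul_le_mul_of_nonneg_right (hφ a)
          exact (Finset.prod_nonneg fun j _ => mul_nonneg (hC j) (mellinW_nonneg _ _))

lemma measurable_real_sign : Measurable Real.sign := by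
  unfold Real.sign
  refine Measurable.ite measurableSet_Iio measurable_const ?_
  exact Measurable.ite measurableSet_Ioi measurable_const measurable_const

lemma mellinIntegrand_measurable (k : ℕ) (lam : Fin k → ℂ) (m n : Fin k → ℕ)
    (φ : SchwartzMap (Fin k → ℝ) ℂ) (s : ℂ) : Measurable (mellinIntegrand k lam m n φ s) := by
  unfold mellinIntegrand
  refine Measurable.ite ?_ ?_ measurable_const
  · have : {a : Fin k → ℝ | ∀ j, a j ≠ 0} = ⋂ j, {a | a j ≠ 0} := by ext; simp
    rw [this]
    refine MeasurableSet.iInter fun j => ?_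
    exact (measurableSet_eq_fun (measurable_pi_apply j) measurable_const).compl
  · refine φ.continuous.measurable.mul (Finset.measurable_prod _ fun j _ => ?_)
    have hj : Measurable fun a : Fin k → ℝ => a j := measurable_pi_apply j
    have h2 : Measurable fun a : Fin k → ℝ => |a j| := continuous_abs.measurable.comp hj
    refine Measurable.mul (Measurable.mul ?_ ?_) ?_
    · exact (Complex.measurable_ofReal.comp (measurable_real_sign.comp hj)).pow_const _
    · exact (Complex.measurable_ofReal.comp h2).pow_const _
    · exact (Complex.measurable_ofReal.comp (Real.measurable_log.comp h2)).pow_const _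

lemma mellinIntegrand_norm_le {k : ℕ} (lam : Fin k → ℂ) (m n : Fin k → ℕ)
    (φ : SchwartzMap (Fin k → ℝ) ℂ) (s : ℂ) (a : Fin k → ℝ) (ha : ∀ j, a j ≠ 0) :
    ‖mellinIntegrand k lam m n φ s a‖ ≤ ‖φ a‖ *
      ∏ j, (|a j| ^ ((s + lam j).re - 1) * (1 + |Real.log (|a j|)|) ^ n j) := by
  unfold mellinIntegrand
  rw [if_pos ha, norm_mul, norm_prod]
  gcongr with j
  have hp : 0 < |a j| := abs_pos.2 (ha j)
  rw [norm_mul, norm_mul, norm_pow, norm_pow, Complex.norm_cpow_eq_rpow_re_of_pos hp]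
  have h1 : ‖((Real.sign (a j) : ℝ) : ℂ)‖ = 1 := by
    rcases Real.sign_apply_eq_of_ne_zero _ (ha j) with h | h <;> simp [h]
  rw [h1, one_pow, one_mul, Complex.norm_real, Real.norm_eq_abs]
  simp only [Complex.sub_re, Complex.one_re]
  gcongr
  linarith

lemma mellinIntegrand_integrable {k : ℕ} (lam : Fin k → ℂ) (m n : Fin k → ℕ)
    (φ : SchwartzMap (Fin k → ℝ) ℂ) (s : ℂ) (hs : ∀ j, -(lam j).re < s.re) :
    Integrable (mellinIntegrand k lam m n φ s) := by
  obtain ⟨B, hB, hB0, h⟩ := mellin_dom φ (fun j => (s + lam j).re) (fun j => (s + lam j).re)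
    (fun j => by simp; linarith [hs j]) n
  refine hB.mono' (mellinIntegrand_measurable k lam m n φ s).aestronglyMeasurable
    (Filter.Eventually.of_forall fun a => ?_)
  by_cases ha : ∀ j, a j ≠ 0
  · exact (mellinIntegrand_norm_le lam m n φ s a ha).trans
      (h a ha _ (fun _ => le_rfl) (fun _ => le_rfl))
  · unfold mellinIntegrand
    rw [if_neg ha]
    simpa using hB0 a

lemma mellinIntegrand_exp {k : ℕ} (lam : Fin k → ℂ) (m n : Fin k → ℕ)
    (φ : SchwartzMap (Fin k → ℝ) ℂ) (s : ℂ) (a : Fin k → ℝ) :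
    mellinIntegrand k lam m n φ s a = mellinIntegrand k lam m n φ 0 a *
      Complex.exp (s * ((∑ j, Real.log (|a j|) : ℝ) : ℂ)) := by
  unfold mellinIntegrand
  by_cases ha : ∀ j, a j ≠ 0
  · rw [if_pos ha, if_pos ha]
    push_cast
    rw [Finset.mul_sum, Complex.exp_sum, mul_assoc, ← Finset.prod_mul_distrib]
    congr 1
    refine Finset.prod_congr rfl fun j _ => ?_
    have hp : ((|a j| : ℝ) : ℂ) ≠ 0 := by exact_mod_cast abs_ne_zero.2 (ha j)
    rw [Complex.cpow_def_of_ne_zero hp, Complex.cpow_def_of_ne_zero hp,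
      ← Complex.ofReal_log (abs_nonneg _)]
    have : Complex.exp (((Real.log (|a j|) : ℝ) : ℂ) * (s + lam j - 1)) =
        Complex.exp (((Real.log (|a j|) : ℝ) : ℂ) * (0 + lam j - 1)) *
        Complex.exp (s * ((Real.log (|a j|) : ℝ) : ℂ)) := by
      rw [← Complex.exp_add]; ring_nf
    rw [this]; ring
  · rw [if_neg ha, if_neg ha, zero_mul]

lemma one_add_sum_le_prod_aux {ι : Type*} (S : Finset ι) (f : ι → ℝ) (hf : ∀ i, 0 ≤ f i) :
    1 + ∑ i ∈ S, f i ≤ ∏ i ∈ S, (1 + f i) := by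
  classical
  induction S using Finset.induction_on with
  | empty => simp
  | insert a S ha ih =>
    rw [Finset.sum_insert ha, Finset.prod_insert ha]
    have h1 : 0 ≤ ∑ i ∈ S, f i := Finset.sum_nonneg fun i _ => hf i
    nlinarith [hf a, mul_nonneg (hf a) h1, mul_le_mul_of_nonneg_left ih (hf a)]

lemma mellinF_differentiableAt {k : ℕ} (lam : Fin k → ℂ) (m n : Fin k → ℕ)
    (φ : SchwartzMap (Fin k → ℝ) ℂ) (s : ℂ) (hs : ∀ j, -(lam j).re < s.re) :
    DifferentiableAt ℂ (mellinF k lam m n φ) s := by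
  have hp : ∀ j, 0 < (s + lam j).re := fun j => by simp; linarith [hs j]
  obtain ⟨B, hB, hB0, h⟩ := mellin_dom φ (fun j => (s + lam j).re / 2)
    (fun j => 2 * (s + lam j).re) (fun j => half_pos (hp j)) (fun j => n j + 1)
  let S : Set ℂ := {z | ∀ j, (s + lam j).re / 2 < (z + lam j).re ∧ (z + lam j).re < 2 * (s + lam j).re}
  have hS : S ∈ nhds s := by
    change ∀ᶠ z in nhds s, ∀ j, _
    rw [Filter.eventually_all]
    intro j
    have hc : ContinuousAt (fun z : ℂ => (z + lam j).re) s := by fun_prop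
    exact (hc.eventually (lt_mem_nhds (by linarith [hp j]))).and
      (hc.eventually (gt_mem_nhds (by linarith [hp j])))
  have hE : Measurable fun a : Fin k → ℝ => ((∑ j, Real.log (|a j|) : ℝ) : ℂ) := by
    refine Complex.measurable_ofReal.comp (Finset.measurable_sum _ fun j _ => ?_)
    exact Real.measurable_log.comp (continuous_abs.measurable.comp (measurable_pi_apply j))
  have key := hasDerivAt_integral_of_dominated_loc_of_deriv_le (μ := (volume : Measure (Fin k → ℝ)))
    (F := fun z a => mellinIntegrand k lam m n φ z a) (x₀ := s) (bound := B)
    (F' := fun z a => mellinIntegrand k lam m n φ z a * ((∑ j, Real.log (|a j|) : ℝ) : ℂ))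
    hS (Filter.Eventually.of_forall fun z =>
      (mellinIntegrand_measurable k lam m n φ z).aestronglyMeasurable)
    (mellinIntegrand_integrable lam m n φ s hs)
    ((mellinIntegrand_measurable k lam m n φ s).mul hE).aestronglyMeasurable
    (Filter.Eventually.of_forall fun a z hz => ?_) hB
    (Filter.Eventually.of_forall fun a z hz => ?_)
  · exact key.2.differentiableAt
  · by_cases ha : ∀ j, a j ≠ 0
    · refine le_trans ?_ (h a ha (fun j => (z + lam j).re) (fun j => (hz j).1.le)
        (fun j => (hz j).2.le))
      rw [norm_mul, Complex.norm_real, Real.norm_eq_abs]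
      have h1 : |∑ j, Real.log (|a j|)| ≤ ∏ j, (1 + |Real.log (|a j|)|) := by
        refine (Finset.abs_sum_le_sum_abs _ _).trans ?_
        have := one_add_sum_le_prod_aux Finset.univ (fun j => |Real.log (|a j|)|)
          (fun j => abs_nonneg _)
        linarith
      calc _ ≤ (‖φ a‖ * ∏ j, (|a j| ^ ((z + lam j).re - 1) * (1 + |Real.log (|a j|)|) ^ n j)) *
            ∏ j, (1 + |Real.log (|a j|)|) := by
            gcongr
            exact mellinIntegrand_norm_le lam m n φ z a ha
        _ = _ := by
            rw [mul_assoc, ← Finset.prod_mul_distrib]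
            simp only [pow_succ, mul_assoc]
    · unfold mellinIntegrand
      rw [if_neg ha]
      simpa using hB0 a
  · have h0 : (fun z => mellinIntegrand k lam m n φ z a) = fun z => mellinIntegrand k lam m n φ 0 a *
      Complex.exp (z * ((∑ j, Real.log (|a j|) : ℝ) : ℂ)) :=
      funext fun z => mellinIntegrand_exp lam m n φ z a
    rw [h0, mellinIntegrand_exp lam m n φ z a, mul_assoc]
    refine HasDerivAt.const_mul _ ?_
    exact ((hasDerivAt_mul_const _).cexp)

/-- One-variable factor. -/
noncomputable def mellinU (m n : ℕ) (w : ℂ) (t : ℝ) : ℂ :=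
  ((Real.sign t : ℝ) : ℂ) ^ m * ((|t| : ℝ) : ℂ) ^ (w - 1) * ((Real.log (|t|) : ℝ) : ℂ) ^ n

lemma mellinU_hasDerivAt (m n : ℕ) (w : ℂ) (t : ℝ) (ht : t ≠ 0) :
    HasDerivAt (mellinU (m + 1) n (w + 1)) (w * mellinU m n w t + n * mellinU m (n - 1) w t) t := by
  obtain ⟨c, hc, hcs, hct⟩ : ∃ c : ℝ, c * c = 1 ∧ (∀ᶠ x in nhds t, Real.sign x = c) ∧ |t| = c * t := by
    rcases lt_or_gt_of_ne ht with h | h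
    · refine ⟨-1, by norm_num, ?_, by rw [abs_of_neg h]; ring⟩
      filter_upwards [gt_mem_nhds h] with x hx using Real.sign_of_neg hx
    · refine ⟨1, by norm_num, ?_, by rw [abs_of_pos h]; ring⟩
      filter_upwards [lt_mem_nhds h] with x hx using Real.sign_of_pos hx
  have hcC : (c : ℂ) * c = 1 := by exact_mod_cast hc
  have heq : mellinU (m + 1) n (w + 1) =ᶠ[nhds t] fun x : ℝ =>
      (c : ℂ) ^ (m + 1) * (Complex.exp (((Real.log x : ℝ) : ℂ) * w) * ((Real.log x : ℝ) : ℂ) ^ n) := by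
    filter_upwards [hcs, isOpen_ne.mem_nhds ht] with x hx hx0
    have hp : ((|x| : ℝ) : ℂ) ≠ 0 := by exact_mod_cast abs_ne_zero.2 hx0
    unfold mellinU
    rw [hx, Complex.cpow_def_of_ne_zero hp, ← Complex.ofReal_log (abs_nonneg _), Real.log_abs,
      add_sub_cancel_right, mul_assoc]
  refine HasDerivAt.congr_of_eventuallyEq ?_ heq
  have hl : HasDerivAt (fun x : ℝ => ((Real.log x : ℝ) : ℂ)) ((t⁻¹ : ℝ) : ℂ) t :=
    (Real.hasDerivAt_log ht).ofReal_comp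
  have hd := ((hl.mul_const w).cexp.mul (hl.pow n)).const_mul ((c : ℂ) ^ (m + 1))
  refine hd.congr_deriv ?_
  have hp : ((|t| : ℝ) : ℂ) ≠ 0 := by exact_mod_cast abs_ne_zero.2 ht
  have htC : (t : ℂ) ≠ 0 := by exact_mod_cast ht
  have e1 : ((|t| : ℝ) : ℂ) ^ (w - 1) = Complex.exp (((Real.log t : ℝ) : ℂ) * w) * (c * (t : ℂ)⁻¹) := by
    rw [Complex.cpow_sub _ _ hp, Complex.cpow_one, Complex.cpow_def_of_ne_zero hp,
      ← Complex.ofReal_log (abs_nonneg _), Real.log_abs, hct]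
    have hc0 : (c : ℂ) ≠ 0 := left_ne_zero_of_mul_eq_one hcC
    push_cast
    rw [div_eq_mul_inv, mul_inv, inv_eq_of_mul_eq_one_right hcC]
  unfold mellinU
  rw [e1, hcs.self_of_nhds, Real.log_abs]
  simp only [Pi.pow_apply]
  push_cast
  ring

lemma mellinU_tendsto (m n : ℕ) (w : ℂ) (hw : 0 < w.re) :
    Filter.Tendsto (mellinU m n (w + 1)) (nhdsWithin 0 {0}ᶜ) (nhds 0) := by
  have h1 : Filter.Tendsto (fun x : ℝ => |Real.log x| ^ (n : ℝ) / x ^ (-w.re))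
      (nhdsWithin 0 (Set.Ioi 0)) (nhds 0) :=
    (isLittleO_abs_log_rpow_rpow_nhdsGT_zero (n : ℝ) (neg_lt_zero.2 hw)).tendsto_div_nhds_zero
  have h2 := h1.comp tendsto_abs_nhdsNE_zero
  refine squeeze_zero_norm' ?_ h2
  filter_upwards [self_mem_nhdsWithin] with t ht
  have ht : t ≠ 0 := ht
  have hp : 0 < |t| := abs_pos.2 ht
  unfold mellinU
  have h1 : ‖((Real.sign t : ℝ) : ℂ)‖ = 1 := by
    rcases Real.sign_apply_eq_of_ne_zero _ ht with h | h <;> simp [h]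
  rw [norm_mul, norm_mul, norm_pow, norm_pow, Complex.norm_cpow_eq_rpow_re_of_pos hp, h1,
    one_pow, one_mul, Complex.norm_real, Real.norm_eq_abs, add_sub_cancel_right]
  simp only [Function.comp]
  rw [Real.rpow_neg hp.le, div_inv_eq_mul, Real.rpow_natCast, mul_comm]

lemma mellinIntegrand_update {k : ℕ} (lam lam' : Fin k → ℂ) (m n m' n' : Fin k → ℕ) (j : Fin k)
    (hl : ∀ i, i ≠ j → lam' i = lam i) (hm : ∀ i, i ≠ j → m' i = m i)
    (hn : ∀ i, i ≠ j → n' i = n i)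
    (φ : SchwartzMap (Fin k → ℝ) ℂ) (s : ℂ) (a : Fin k → ℝ) (ha : ∀ i, i ≠ j → a i ≠ 0)
    (t : ℝ) (ht : t ≠ 0) :
    mellinIntegrand k lam' m' n' φ s (Function.update a j t) = φ (Function.update a j t) *
      (mellinU (m' j) (n' j) (s + lam' j) t *
        ∏ i ∈ Finset.univ.erase j, mellinU (m i) (n i) (s + lam i) (a i)) := by
  unfold mellinIntegrand
  rw [if_pos]
  · rw [← Finset.mul_prod_erase Finset.univ _ (Finset.mem_univ j)]
    congr 2
    · simp [mellinU]
    · refine Finset.prod_congr rfl fun i hi => ?_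
      have hij := (Finset.mem_erase.1 hi).1
      rw [Function.update_of_ne hij, hl i hij, hm i hij, hn i hij, mellinU]
  · intro i
    by_cases h : i = j
    · subst h; simpa using ht
    · rw [Function.update_of_ne h]; exact ha i h

lemma mellinIntegrand_eq_zero {k : ℕ} (lam : Fin k → ℂ) (m n : Fin k → ℕ)
    (φ : SchwartzMap (Fin k → ℝ) ℂ) (s : ℂ) (a : Fin k → ℝ) (i : Fin k) (h : a i = 0) :
    mellinIntegrand k lam m n φ s a = 0 := by
  unfold mellinIntegrand
  rw [if_neg]
  push Not
  exact ⟨i, h⟩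

lemma integral_deriv_line (f f' : ℝ → ℂ) (hf : Integrable f) (hf' : Integrable f')
    (hd : ∀ t, t ≠ 0 → HasDerivAt f (f' t) t) (hc : ContinuousAt f 0) : ∫ t, f' t = 0 := by
  have t1 : Filter.Tendsto f Filter.atTop (nhds 0) :=
    tendsto_zero_of_hasDerivAt_of_integrableOn_Ioi (a := 0) (fun x hx => hd x (ne_of_gt hx))
      hf'.integrableOn hf.integrableOn
  have t2 : Filter.Tendsto f Filter.atBot (nhds 0) :=
    tendsto_zero_of_hasDerivAt_of_integrableOn_Iic (a := -1)
      (fun x hx => hd x (by have : x ≤ -1 := hx; linarith))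
      hf'.integrableOn hf.integrableOn
  have i1 := integral_Ioi_of_hasDerivAt_of_tendsto (a := 0) hc.continuousWithinAt
    (fun x hx => hd x (ne_of_gt hx)) hf'.integrableOn t1
  have i2 := integral_Iic_of_hasDerivAt_of_tendsto (a := 0) hc.continuousWithinAt
    (fun x hx => hd x (ne_of_lt hx)) hf'.integrableOn t2
  rw [← intervalIntegral.integral_Iic_add_Ioi (b := 0) hf'.integrableOn hf'.integrableOn, i1, i2]
  ring

lemma integral_deriv_slice {k : ℕ} (j : Fin k) (G D : (Fin k → ℝ) → ℂ)
    (hG : Integrable G) (hD : Integrable D)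
    (hd : ∀ a t, t ≠ 0 → HasDerivAt (fun t => G (Function.update a j t)) (D (Function.update a j t)) t)
    (hc : ∀ a, ContinuousAt (fun t => G (Function.update a j t)) 0) : ∫ a, D a = 0 := by
  obtain ⟨k, rfl⟩ : ∃ l, k = l + 1 := ⟨k - 1, by have := j.pos; omega⟩
  have hmp := (volume_preserving_piFinSuccAbove (fun _ : Fin (k + 1) => ℝ) j).symm
  have hG' := (hmp.integrable_comp_emb (MeasurableEquiv.measurableEmbedding _)).2 hG
  have hD' := (hmp.integrable_comp_emb (MeasurableEquiv.measurableEmbedding _)).2 hD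
  rw [← hmp.integral_comp (MeasurableEquiv.measurableEmbedding _) D]
  rw [Measure.volume_eq_prod] at hG' hD' ⊢
  have e := integral_prod_symm _ hD'
  simp only [Function.comp] at e
  rw [e]
  refine integral_eq_zero_of_ae ?_
  filter_upwards [hG'.prod_left_ae, hD'.prod_left_ae] with b h1 h2
  have hu : ∀ t : ℝ, (MeasurableEquiv.piFinSuccAbove (fun _ : Fin (k + 1) => ℝ) j).symm (t, b) =
      Function.update (j.insertNth (α := fun _ => ℝ) 0 b) j t := by
    intro t
    rw [Fin.update_insertNth]
    rfl
  simp only [Function.comp, hu] at h1 h2 ⊢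
  exact integral_deriv_line _ _ h1 h2 (hd _) (hc _)

open LineDeriv in
lemma mellin_parts {k : ℕ} (j : Fin k) (lam : Fin k → ℂ) (m n : Fin k → ℕ)
    (φ : SchwartzMap (Fin k → ℝ) ℂ) (s : ℂ) (hs : ∀ i, -(lam i).re < s.re) :
    (s + lam j) * mellinF k lam m n φ s =
      - mellinF k (Function.update lam j (lam j + 1)) (Function.update m j (m j + 1)) n
        (∂_{(Pi.single j (1 : ℝ) : Fin k → ℝ)} φ) s
      - n j * mellinF k lam m (Function.update n j (n j - 1)) φ s := by
  have hs' : ∀ i, -(Function.update lam j (lam j + 1) i).re < s.re := by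
    intro i
    by_cases h : i = j
    · subst h; simp; linarith [hs i]
    · rw [Function.update_of_ne h]; exact hs i
  have I0 := mellinIntegrand_integrable _ (Function.update m j (m j + 1)) n φ s hs'
  have I1 := mellinIntegrand_integrable _ (Function.update m j (m j + 1)) n
    (∂_{(Pi.single j (1 : ℝ) : Fin k → ℝ)} φ) s hs'
  have I2 := mellinIntegrand_integrable lam m n φ s hs
  have I3 := mellinIntegrand_integrable lam m (Function.update n j (n j - 1)) φ s hs
  have I2' := I2.const_mul (s + lam j)
  have I3' := I3.const_mul (n j : ℂ)
  have key := integral_deriv_slice j _ _ I0 ((I1.add I2').add I3') ?_ ?_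
  · have e : ∫ a, ((mellinIntegrand k (Function.update lam j (lam j + 1))
        (Function.update m j (m j + 1)) n (∂_{(Pi.single j (1 : ℝ) : Fin k → ℝ)} φ) s +
        fun a => (s + lam j) * mellinIntegrand k lam m n φ s a) + fun a => (n j : ℂ) *
        mellinIntegrand k lam m (Function.update n j (n j - 1)) φ s a) a = _ := key
    rw [integral_add' (I1.add I2') I3', integral_add' I1 I2', integral_const_mul,
      integral_const_mul] at e
    unfold mellinF
    linear_combination e
  · intro a t ht
    by_cases ha : ∀ i, i ≠ j → a i ≠ 0
    · have up := fun (lam' : Fin k → ℂ) (m' n' : Fin k → ℕ) hl hm hn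
        (ψ : SchwartzMap (Fin k → ℝ) ℂ) (x : ℝ) (hx : x ≠ 0) =>
        mellinIntegrand_update lam lam' m n m' n' j hl hm hn ψ s a ha x hx
      have hφ : HasDerivAt (fun x => φ (Function.update a j x))
          ((∂_{(Pi.single j (1 : ℝ) : Fin k → ℝ)} φ) (Function.update a j t)) t := by
        rw [SchwartzMap.lineDerivOp_apply_eq_fderiv]
        exact (φ.differentiableAt.hasFDerivAt).comp_hasDerivAt t (hasDerivAt_update a j t)
      have hU := mellinU_hasDerivAt (m j) (n j) (s + lam j) t ht
      have hd := hφ.mul (hU.mul_const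
        (∏ i ∈ Finset.univ.erase j, mellinU (m i) (n i) (s + lam i) (a i)))
      refine (hd.congr_of_eventuallyEq ?_).congr_deriv ?_
      · filter_upwards [isOpen_ne.mem_nhds ht] with x hx
        rw [up _ _ _ (fun i hi => Function.update_of_ne hi _ _)
          (fun i hi => Function.update_of_ne hi _ _) (fun i hi => rfl) φ x hx]
        simp [add_assoc]
      · simp only [Pi.add_apply]
        rw [up _ _ _ (fun i hi => Function.update_of_ne hi _ _)
          (fun i hi => Function.update_of_ne hi _ _) (fun i hi => rfl) _ t ht,
          up _ _ _ (fun i hi => rfl) (fun i hi => rfl) (fun i hi => rfl) _ t ht,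
          up _ _ _ (fun i hi => rfl) (fun i hi => rfl)
            (fun i hi => Function.update_of_ne hi _ _) _ t ht]
        simp only [Function.update_self, add_assoc]
        ring
    · push Not at ha
      obtain ⟨i, hi, h0⟩ := ha
      have hz := fun (lam' : Fin k → ℂ) (m' n' : Fin k → ℕ) (ψ : SchwartzMap (Fin k → ℝ) ℂ) (x : ℝ) =>
        mellinIntegrand_eq_zero lam' m' n' ψ s (Function.update a j x) i
          (by rw [Function.update_of_ne hi, h0])
      simp only [Pi.add_apply, hz, mul_zero, add_zero]
      exact hasDerivAt_const _ _
  · intro a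
    rw [continuousAt_iff_punctured_nhds,
      mellinIntegrand_eq_zero _ _ _ _ _ (Function.update a j 0) j (by simp)]
    by_cases ha : ∀ i, i ≠ j → a i ≠ 0
    · have hw : 0 < (s + lam j).re := by simp; linarith [hs j]
      have c1 : Filter.Tendsto (fun x => φ (Function.update a j x)) (nhdsWithin 0 {0}ᶜ)
          (nhds (φ (Function.update a j 0))) := by
        have : Continuous fun x => φ (Function.update a j x) :=
          φ.continuous.comp (continuous_const.update j continuous_id)
        exact this.continuousAt.tendsto.mono_left nhdsWithin_le_nhds
      have c2 := c1.mul ((mellinU_tendsto (m j + 1) (n j) (s + lam j) hw).mul_const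
        (∏ i ∈ Finset.univ.erase j, mellinU (m i) (n i) (s + lam i) (a i)))
      rw [zero_mul, mul_zero] at c2
      refine c2.congr' ?_
      filter_upwards [self_mem_nhdsWithin] with x hx
      rw [mellinIntegrand_update lam _ m n _ _ j (fun i hi => Function.update_of_ne hi _ _)
        (fun i hi => Function.update_of_ne hi _ _) (fun i hi => rfl) φ s a ha x hx]
      simp [add_assoc]
    · push Not at ha
      obtain ⟨i, hi, h0⟩ := ha
      have hz := fun (x : ℝ) => mellinIntegrand_eq_zero (Function.update lam j (lam j + 1))
          (Function.update m j (m j + 1)) n φ s (Function.update a j x) i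
          (by rw [Function.update_of_ne hi, h0])
      simp only [hz]
      exact tendsto_const_nhds

/-- The continuation property. -/
def MellinCont (k : ℕ) (M : ℝ) (lam : Fin k → ℂ) (m n : Fin k → ℕ) : Prop :=
    ∃ Q : Polynomial ℂ, Q ≠ 0 ∧
      ∀ φ : SchwartzMap (Fin k → ℝ) ℂ, ∃ H : ℂ → ℂ,
        DifferentiableOn ℂ H {s : ℂ | -M < s.re} ∧
        ∀ s : ℂ, -M < s.re → (∀ j, -(lam j).re < s.re) →
          Q.eval s * mellinF k lam m n φ s = H s

lemma mellinCont_base {k : ℕ} {M : ℝ} (lam : Fin k → ℂ) (m n : Fin k → ℕ)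
    (h : ∀ j, M < (lam j).re) : MellinCont k M lam m n := by
  refine ⟨1, one_ne_zero, fun φ => ⟨mellinF k lam m n φ, ?_, fun s _ _ => by simp⟩⟩
  intro s hs
  have hs : -M < s.re := hs
  exact (mellinF_differentiableAt lam m n φ s
    (fun j => by linarith [h j])).differentiableWithinAt

open LineDeriv in
lemma mellinCont_step {k : ℕ} {M : ℝ} (j : Fin k) (lam : Fin k → ℂ) (m n : Fin k → ℕ)
    (h1 : MellinCont k M (Function.update lam j (lam j + 1)) (Function.update m j (m j + 1)) n)
    (h2 : n j = 0 ∨ MellinCont k M lam m (Function.update n j (n j - 1))) :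
    MellinCont k M lam m n := by
  obtain ⟨Q1, hQ1, h1⟩ := h1
  have hX : (Polynomial.X + Polynomial.C (lam j)) ≠ 0 := Polynomial.X_add_C_ne_zero _
  have hs' : ∀ s : ℂ, (∀ i, -(lam i).re < s.re) →
      ∀ i, -(Function.update lam j (lam j + 1) i).re < s.re := by
    intro s hs i
    by_cases h : i = j
    · subst h; simp; linarith [hs i]
    · rw [Function.update_of_ne h]; exact hs i
  rcases h2 with h2 | ⟨Q2, hQ2, h2⟩
  · refine ⟨Q1 * (Polynomial.X + Polynomial.C (lam j)), mul_ne_zero hQ1 hX, fun φ => ?_⟩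
    obtain ⟨H1, d1, e1⟩ := h1 (∂_{(Pi.single j (1 : ℝ) : Fin k → ℝ)} φ)
    refine ⟨fun s => - H1 s, d1.neg, fun s hM hs => ?_⟩
    have p := mellin_parts j lam m n φ s hs
    have q := e1 s hM (hs' s hs)
    rw [h2, Nat.cast_zero, zero_mul] at p
    simp only [Polynomial.eval_mul, Polynomial.eval_add, Polynomial.eval_X, Polynomial.eval_C]
    linear_combination Q1.eval s * p - q
  · refine ⟨Q1 * Q2 * (Polynomial.X + Polynomial.C (lam j)),
      mul_ne_zero (mul_ne_zero hQ1 hQ2) hX, fun φ => ?_⟩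
    obtain ⟨H1, d1, e1⟩ := h1 (∂_{(Pi.single j (1 : ℝ) : Fin k → ℝ)} φ)
    obtain ⟨H2, d2, e2⟩ := h2 φ
    refine ⟨fun s => - (Q2.eval s * H1 s) - n j * (Q1.eval s * H2 s), ?_, fun s hM hs => ?_⟩
    · exact ((Q2.differentiable.differentiableOn.mul d1).neg).sub
        ((Q1.differentiable.differentiableOn.mul d2).const_mul _)
    have p := mellin_parts j lam m n φ s hs
    have q1 := e1 s hM (hs' s hs)
    have q2 := e2 s hM hs
    simp only [Polynomial.eval_mul, Polynomial.eval_add, Polynomial.eval_X, Polynomial.eval_C]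
    linear_combination Q1.eval s * Q2.eval s * p - Q2.eval s * q1 - n j * Q1.eval s * q2

lemma mellinCont_all {k : ℕ} {M : ℝ} : ∀ (T : ℕ) (N : Fin k → ℕ), ∑ j, N j = T →
    ∀ (lam : Fin k → ℂ) (m n : Fin k → ℕ), (∀ j, M < (lam j).re + N j) →
      MellinCont k M lam m n := by
  intro T
  induction T with
  | zero =>
    intro N hN lam m n h
    refine mellinCont_base lam m n fun j => ?_
    have := (Finset.sum_eq_zero_iff.1 hN) j (Finset.mem_univ j)
    simpa [this] using h j
  | succ T ih =>
    intro N hN lam m n h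
    obtain ⟨j, hj⟩ : ∃ j, N j ≠ 0 := by
      by_contra hcon
      push Not at hcon
      simp [hcon] at hN
    have hsum : ∑ i, Function.update N j (N j - 1) i = T := by
      rw [Finset.sum_update_of_mem (Finset.mem_univ j)]
      rw [← Finset.add_sum_erase Finset.univ N (Finset.mem_univ j), Finset.erase_eq] at hN
      omega
    have hstep : ∀ m n : Fin k → ℕ, MellinCont k M (Function.update lam j (lam j + 1)) m n := by
      intro m n
      refine ih _ hsum _ m n fun i => ?_
      by_cases hi : i = j
      · subst hi
        have := h i
        simp only [Function.update_self, Complex.add_re, Complex.one_re]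
        rw [Nat.cast_sub (Nat.one_le_iff_ne_zero.2 hj)]
        push_cast
        linarith
      · rw [Function.update_of_ne hi, Function.update_of_ne hi]; exact h i
    obtain ⟨q, hq⟩ : ∃ q, n j = q := ⟨_, rfl⟩
    induction q generalizing n with
    | zero => exact mellinCont_step j lam m n (hstep _ _) (Or.inl hq)
    | succ q ihq =>
      exact mellinCont_step j lam m n (hstep _ _) (Or.inr (ihq _ (by simp [hq])))

/-- for every M > 0 there exists a nonzero polynomial Q ∈ ℂ[X] depending
only on M, k and the data (λ_j, m_j, n_j) (not on φ), such that for every Schwartz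
function φ there is a function H holomorphic on {s : Re(s) > −M} with
Q(s)·F_φ(s) = H(s) whenever Re(s) > −M and Re(s) > −Re(λ_j) for all j; hence F_φ
extends meromorphically to {s : Re(s) > −M}, and (M being arbitrary) to all of ℂ. -/
theorem mellinF_meromorphic_continuation (k : ℕ) (hk : 1 ≤ k) (lam : Fin k → ℂ)
    (m n : Fin k → ℕ) (M : ℝ) (hM : 0 < M) :
    ∃ Q : Polynomial ℂ, Q ≠ 0 ∧
      ∀ φ : SchwartzMap (Fin k → ℝ) ℂ, ∃ H : ℂ → ℂ,
        DifferentiableOn ℂ H {s : ℂ | -M < s.re} ∧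
        ∀ s : ℂ, -M < s.re → (∀ j, -(lam j).re < s.re) →
          Q.eval s * mellinF k lam m n φ s = H s := by
  choose N hN using fun j => exists_nat_gt (M - (lam j).re)
  exact mellinCont_all _ N rfl lam m n fun j => by linarith [hN j]
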